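/- Let ε, δ > 0 and let Φ̂ be the (ε,δ)-count-min sketch of the features of a stream σ over a finite alphabet A (built from r = ⌈log_2(1/δ)⌉ independent uniform draws from a 2-universal family into an alphabet of size ⌈2/ε⌉). Then for every word w of length M, ℙ( |Φ̂_w(σ) − Φ_w(σ)| > ε · ‖σ‖^M / M! ) ≤ δ, where ‖σ‖ := Σ_{i=1}^L λ_i and the features are taken with respect to the event map p(λ,a) = 1+λa. -/

import Mathlib

open scoped BigOperators Classical

/-- Feature coordinates of a stream `σ` at a word `w` for the event map `p(λ,a) = 1 + λ a`:
the sum over all strictly increasing index tuples whose letters spell `w` of the product of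
the counter increases. -/
noncomputable def Phi {A : Type*} (σ : List (ℝ × A)) (w : List A) : ℝ :=
  ∑ i : Fin w.length → Fin σ.length,
    if (∀ j k : Fin w.length, j < k → i j < i k) ∧
        (∀ j : Fin w.length, (σ.get (i j)).2 = w.get j) then
      ∏ j : Fin w.length, (σ.get (i j)).1
    else 0

/-- The block factorial `𝐢!` of a (nondecreasing) index tuple: the product over values of the
factorial of the number of occurrences. -/
def iFact {M L : ℕ} (i : Fin M → Fin L) : ℕ :=
  ∏ v : Fin L, Nat.factorial ((List.ofFn i).count v)

/-- Feature coordinates of a stream `σ` at a word `w` for the event map `p(λ,a) = exp(λ a)`: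
the sum over all nondecreasing index tuples whose letters spell `w` of the product of the
counter increases divided by the block factorial `𝐢!`. -/
noncomputable def PhiExp {A : Type*} (σ : List (ℝ × A)) (w : List A) : ℝ :=
  ∑ i : Fin w.length → Fin σ.length,
    if (∀ j k : Fin w.length, j ≤ k → i j ≤ i k) ∧
        (∀ j : Fin w.length, (σ.get (i j)).2 = w.get j) then
      (∏ j : Fin w.length, (σ.get (i j)).1) / (iFact i : ℝ)
    else 0

/-- The hashed stream `σ^h`. -/
def hashStream {A B : Type*} (h : A → B) (σ : List (ℝ × A)) : List (ℝ × B) :=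
  σ.map (fun e => (e.1, h e.2))

/-- Pulled-back features `Φ_{h,w}(σ) := Φ_{h(w)}(σ^h)` for the event map `p(λ,a) = 1 + λ a`. -/
noncomputable def PhiH {A B : Type*} (h : A → B) (σ : List (ℝ × A)) (w : List A) : ℝ :=
  Phi (hashStream h σ) (w.map h)

/-- Pulled-back features `Φ_{h,w}(σ) := Φ_{h(w)}(σ^h)` for the event map `p(λ,a) = exp(λ a)`. -/
noncomputable def PhiExpH {A B : Type*} (h : A → B) (σ : List (ℝ × A)) (w : List A) : ℝ :=
  PhiExp (hashStream h σ) (w.map h)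

/-- `‖Φ(σ)‖_{1,(M)}`: the sum of the features over all words of length `M`. -/
noncomputable def phiNorm {A : Type*} [Fintype A] (σ : List (ℝ × A)) (M : ℕ) : ℝ :=
  ∑ f : Fin M → A, Phi σ (List.ofFn f)

/-- Probability of an event `S` under a finitely supported weight `p`. -/
noncomputable def pr {Ω : Type*} [Fintype Ω] (p : Ω → ℝ) (S : Ω → Prop) : ℝ :=
  ∑ ω : Ω, if S ω then p ω else 0

/-- Expectation of `f` under a finitely supported weight `p`. -/
noncomputable def expec {Ω : Type*} [Fintype Ω] (p : Ω → ℝ) (f : Ω → ℝ) : ℝ :=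
  ∑ ω : Ω, p ω * f ω

/-- The pulled-back feature as a sum over index tuples of the original stream and word. -/
theorem PhiH_eq_sum {A B : Type*} (h : A → B) (σ : List (ℝ × A)) (w : List A) :
    PhiH h σ w = ∑ i : Fin w.length → Fin σ.length,
      if StrictMono i ∧ (∀ j, h (σ.get (i j)).2 = h (w.get j)) then
        ∏ j, (σ.get (i j)).1 else 0 := by
  have hw : (w.map h).length = w.length := by simp
  have hs : (hashStream h σ).length = σ.length := by simp [hashStream]
  have hget : ∀ k, (hashStream h σ).get k =
      ((σ.get (finCongr hs k)).1, h (σ.get (finCongr hs k)).2) := fun _ =>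
    List.getElem_map _
  have hcongr : ∀ (i : Fin (w.map h).length → Fin (hashStream h σ).length) j,
      Equiv.arrowCongr (finCongr hw) (finCongr hs) i (finCongr hw j) = finCongr hs (i j) :=
    fun i j => rfl
  unfold PhiH Phi
  refine Fintype.sum_equiv (Equiv.arrowCongr (finCongr hw) (finCongr hs)) _ _ fun i => ?_
  have hprod : ∏ j, ((hashStream h σ).get (i j)).1 =
      ∏ j, (σ.get (Equiv.arrowCongr (finCongr hw) (finCongr hs) i j)).1 :=
    Fintype.prod_equiv (finCongr hw) _ _ fun j => by rw [hcongr, hget]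
  rw [hprod]
  refine if_congr (and_congr ?_ ?_) rfl rfl
  · constructor
    · intro hi j k hjk
      exact hi _ _ (by simpa using hjk)
    · intro hi j k hjk
      simpa using hi (a := finCongr hw j) (b := finCongr hw k) (by simpa using hjk)
  · rw [← (finCongr hw).forall_congr_right]
    simp only [hcongr, hget]
    simp

theorem PhiH_id {A : Type*} (σ : List (ℝ × A)) (w : List A) : PhiH id σ w = Phi σ w := by
  simp [PhiH, hashStream]

/-- The `M`-th elementary symmetric sum of nonnegative reals is at most the `M`-th power of their
sum divided by `M!`. -/
theorem sum_strictMono_prod_le {L : ℕ} (M : ℕ) (f : Fin L → ℝ) (hf : ∀ l, 0 ≤ f l) :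
    ∑ i : Fin M → Fin L with StrictMono i, ∏ j, f (i j) ≤ (∑ l, f l) ^ M / M.factorial := by
  rw [le_div_iff₀ (by positivity), Finset.sum_pow', mul_comm]
  have hinj : Set.InjOn (fun x : (Fin M → Fin L) × Equiv.Perm (Fin M) => x.1 ∘ x.2)
      ((Finset.univ.filter StrictMono ×ˢ Finset.univ :
        Finset ((Fin M → Fin L) × Equiv.Perm (Fin M))) : Set _) := by
    rintro ⟨i, π⟩ hi ⟨i', π'⟩ hi' heq
    simp only [Finset.coe_product, Finset.coe_filter, Finset.coe_univ, Set.mem_prod,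
      Set.mem_ofPred_eq, Finset.mem_univ, true_and, Set.mem_univ, and_true] at hi hi' heq
    have hii : i = i' := by
      rw [← StrictMono.range_inj hi hi', ← π.surjective.range_comp i,
        ← π'.surjective.range_comp i', heq]
    subst hii
    refine Prod.ext rfl (Equiv.ext fun j => hi.injective (congrFun heq j))
  calc (M.factorial : ℝ) * ∑ i : Fin M → Fin L with StrictMono i, ∏ j, f (i j)
      = ∑ x ∈ (Finset.univ.filter StrictMono ×ˢ Finset.univ :
          Finset ((Fin M → Fin L) × Equiv.Perm (Fin M))), ∏ j, f ((x.1 ∘ x.2) j) := by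
        rw [Finset.sum_product, Finset.mul_sum]
        refine Finset.sum_congr rfl fun i _ => ?_
        simp only [Function.comp_apply]
        rw [Finset.sum_congr rfl fun (π : Equiv.Perm (Fin M)) _ =>
          Equiv.prod_comp π fun j => f (i j)]
        simp [Fintype.card_perm]
    _ = ∑ g ∈ Finset.image (fun x : (Fin M → Fin L) × Equiv.Perm (Fin M) => x.1 ∘ x.2)
          (Finset.univ.filter StrictMono ×ˢ Finset.univ), ∏ j, f (g j) :=
        (Finset.sum_image (f := fun g : Fin M → Fin L => ∏ j, f (g j)) hinj).symm
    _ ≤ _ := Finset.sum_le_sum_of_subset_of_nonneg (fun g _ => by simp)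
        fun g _ _ => Finset.prod_nonneg fun j _ => hf _

theorem Phi_le_PhiH {A B : Type*} (h : A → B) (σ : List (ℝ × A)) (hσ : ∀ e ∈ σ, 0 < e.1)
    (w : List A) : Phi σ w ≤ PhiH h σ w := by
  rw [← PhiH_id, PhiH_eq_sum, PhiH_eq_sum]
  refine Finset.sum_le_sum fun i _ => ?_
  have hP : 0 ≤ ∏ j, (σ.get (i j)).1 :=
    Finset.prod_nonneg fun j _ => (hσ _ (List.get_mem _ _)).le
  split_ifs with h₁ h₂
  · exact le_rfl
  · exact absurd ⟨h₁.1, fun j => congrArg h (h₁.2 j)⟩ h₂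
  · exact hP
  · exact le_rfl

/-- First-moment bound: the total excess of the pulled-back features over a family whose collision
frequency is at most `c`. -/
theorem sum_PhiH_sub_Phi_le {A B : Type*} (𝓗 : Finset (A → B)) (c : ℝ)
    (hc : 0 ≤ c) (hcoll : ∀ a b : A, a ≠ b → ((𝓗.filter fun h => h a = h b).card : ℝ) ≤ c)
    (σ : List (ℝ × A)) (hσ : ∀ e ∈ σ, 0 < e.1) (w : List A) :
    ∑ h ∈ 𝓗, (PhiH h σ w - Phi σ w) ≤
      c * ((σ.map Prod.fst).sum ^ w.length / w.length.factorial) := by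
  have hpos : ∀ l, 0 ≤ (σ.get l).1 := fun l => (hσ _ (List.get_mem _ _)).le
  have hsum : ∑ l, (σ.get l).1 = (σ.map Prod.fst).sum := by
    rw [← Fin.sum_univ_fun_getElem]
    rfl
  refine le_trans ?_ (mul_le_mul_of_nonneg_left
    ((sum_strictMono_prod_le w.length _ hpos).trans_eq (by rw [hsum])) hc)
  simp_rw [← PhiH_id σ w, PhiH_eq_sum, ← Finset.sum_sub_distrib]
  rw [Finset.sum_comm, Finset.sum_filter, Finset.mul_sum]
  refine Finset.sum_le_sum fun i _ => ?_
  have hP : 0 ≤ ∏ j, (σ.get (i j)).1 := Finset.prod_nonneg fun j _ => hpos _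
  by_cases hi : StrictMono i
  · simp only [hi, true_and, if_true, id]
    by_cases hs : ∀ j, (σ.get (i j)).2 = w.get j
    · have : ∀ h : A → B, ∀ j, h (σ.get (i j)).2 = h (w.get j) := fun h j => congrArg h (hs j)
      rw [Finset.sum_eq_zero fun h _ => by rw [if_pos (this h), if_pos hs, sub_self]]
      exact mul_nonneg hc hP
    · obtain ⟨j, hj⟩ := not_forall.1 hs
      refine le_trans ?_ (mul_le_mul_of_nonneg_right (hcoll _ _ hj) hP)
      rw [← nsmul_eq_mul, ← Finset.sum_const, Finset.sum_filter]
      refine Finset.sum_le_sum fun h _ => ?_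
      rw [if_neg hs, sub_zero]
      split_ifs with h₁ h₂
      · exact le_rfl
      · exact absurd (h₁ j) h₂
      · exact hP
      · exact le_rfl
  · simp [hi]

/-- Markov's inequality for a counting measure: if a function is nonnegative on `s` and its sum is
at most half of `#s * t`, then it exceeds `t` on at most half of `s`. -/
theorem two_mul_card_filter_lt_le {ι : Type*} (s : Finset ι) (f : ι → ℝ) (t : ℝ) (ht : 0 ≤ t)
    (hf : ∀ x ∈ s, 0 ≤ f x) (hsum : ∑ x ∈ s, f x ≤ s.card * (t / 2)) :
    2 * ((s.filter fun x => t < f x).card : ℝ) ≤ s.card := by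
  rcases (s.filter fun x => t < f x).eq_empty_or_nonempty with he | hne
  · simp [he]
  have hlt : ((s.filter fun x => t < f x).card : ℝ) * t < s.card * (t / 2) := by
    refine lt_of_lt_of_le ?_ hsum
    refine lt_of_lt_of_le ?_
      (Finset.sum_le_sum_of_subset_of_nonneg (Finset.filter_subset (fun x => t < f x) s)
        fun x hx _ => hf x hx)
    rw [← nsmul_eq_mul, ← Finset.sum_const]
    exact Finset.sum_lt_sum_of_nonempty hne fun x hx => (Finset.mem_filter.1 hx).2
  have ht' : 0 < t := ht.lt_of_ne fun h0 => by simp [← h0] at hlt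
  have : (2 * ((s.filter fun x => t < f x).card : ℝ)) * t ≤ s.card * t := by linarith
  exact le_of_mul_le_mul_right this ht'

/-- Under `r` independent uniform draws, an event forcing each draw into a set of at most half the
elements has probability at most `(1/2)^r`. -/
theorem pr_uniform_le_half_pow {ι : Type*} (s : Finset ι) (hs : s.Nonempty) (r : ℕ) (Q : ι → Prop)
    (hQ : 2 * ((s.filter Q).card : ℝ) ≤ s.card) (S : (Fin r → ↥s) → Prop)
    (hS : ∀ ω, S ω → ∀ j, Q (ω j).1) :
    pr (fun _ : Fin r → ↥s => 1 / (s.card : ℝ) ^ r) S ≤ (1 / 2) ^ r := by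
  have hN : (0 : ℝ) < s.card := by exact_mod_cast hs.card_pos
  calc pr (fun _ : Fin r → ↥s => 1 / (s.card : ℝ) ^ r) S
      ≤ ∑ ω : Fin r → ↥s, ∏ j, if Q (ω j).1 then 1 / (s.card : ℝ) else 0 := by
        refine Finset.sum_le_sum fun ω _ => ?_
        split_ifs with h
        · simp [hS ω h]
        · exact Finset.prod_nonneg fun j _ => by split_ifs <;> positivity
    _ = (∑ x : ↥s, if Q x.1 then 1 / (s.card : ℝ) else 0) ^ r := by
        rw [Finset.sum_pow', Fintype.piFinset_univ]
    _ ≤ _ := by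
        have hx : (∑ x : ↥s, if Q x.1 then 1 / (s.card : ℝ) else 0) =
            (s.filter Q).card / (s.card : ℝ) := by
          rw [Finset.sum_coe_sort s fun x => if Q x then 1 / (s.card : ℝ) else 0,
            ← Finset.sum_filter, Finset.sum_const, nsmul_eq_mul, mul_one_div]
        rw [hx]
        refine pow_le_pow_left₀ (by positivity) ?_ r
        rw [div_le_iff₀ hN]
        linarith

theorem half_pow_le_of_logb_le {δ : ℝ} (hδ : 0 < δ) {r : ℕ} (hr : Real.logb 2 (1 / δ) ≤ r) :
    (1 / 2 : ℝ) ^ r ≤ δ := by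
  rw [Real.logb_le_iff_le_rpow one_lt_two (by positivity), Real.rpow_natCast,
    div_le_iff₀ hδ] at hr
  rw [one_div_pow, div_le_iff₀ (by positivity)]
  linarith

/-- Error bound for the `(ε,δ)`-count-min sketch in terms of the length
`‖σ‖ = λ_1 + ⋯ + λ_L` of the stream: for every word `w` of length `M`, the sketch deviates
from `Φ_w(σ)` by more than `ε ‖σ‖^M / M!` with probability at most `δ`.  Features use the
event map `p(λ,a) = 1 + λ a`. -/
theorem count_min_sketch_length_bound {A B : Type*} [Fintype A] [Fintype B]
    (ε δ : ℝ) (hε : 0 < ε) (hδ : 0 < δ)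
    (hB : Fintype.card B = ⌈2 / ε⌉₊)
    (𝓗 : Finset (A → B)) (h𝓗 : 𝓗.Nonempty)
    (huniv : ∀ a b : A, a ≠ b →
      ((𝓗.filter fun h => h a = h b).card : ℝ) / (𝓗.card : ℝ) ≤ 1 / (Fintype.card B : ℝ))
    (r : ℕ) (hr : r = ⌈Real.logb 2 (1 / δ)⌉₊)
    (σ : List (ℝ × A)) (hσ : ∀ e ∈ σ, 0 < e.1)
    (M : ℕ) (w : List A) (hw : w.length = M) :
    pr (fun _ : Fin r → ↥𝓗 => 1 / (𝓗.card : ℝ) ^ r)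
        (fun ω =>
          ε * ((σ.map Prod.fst).sum ^ M / (Nat.factorial M : ℝ)) <
            |(⨅ j : Fin r, PhiH (ω j).1 σ w) - Phi σ w|) ≤ δ := by
  subst hw
  have hN : (0 : ℝ) < 𝓗.card := by exact_mod_cast h𝓗.card_pos
  have hS : 0 ≤ (σ.map Prod.fst).sum := List.sum_nonneg fun x hx => by
    obtain ⟨e, he, rfl⟩ := List.mem_map.1 hx
    exact (hσ e he).le
  set n : ℝ := (σ.map Prod.fst).sum ^ w.length / (w.length.factorial : ℝ) with hn
  have hn0 : 0 ≤ n := by positivity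
  have hBε : 1 / (Fintype.card B : ℝ) ≤ ε / 2 := by
    rw [← one_div_div 2 ε]
    exact one_div_le_one_div_of_le (by positivity) (hB ▸ Nat.le_ceil _)
  have hcoll : ∀ a b : A, a ≠ b →
      ((𝓗.filter fun h => h a = h b).card : ℝ) ≤ 𝓗.card * (ε / 2) := fun a b hab => by
    have := (huniv a b hab).trans hBε
    rwa [div_le_iff₀ hN, mul_comm] at this
  have hhalf := two_mul_card_filter_lt_le 𝓗 (fun h => PhiH h σ w - Phi σ w) (ε * n)
    (by positivity) (fun h _ => sub_nonneg.2 (Phi_le_PhiH h σ hσ w))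
    ((sum_PhiH_sub_Phi_le 𝓗 _ (by positivity) hcoll σ hσ w).trans_eq (by rw [← hn]; ring))
  refine (pr_uniform_le_half_pow 𝓗 h𝓗 r _ hhalf _ fun ω hω j => ?_).trans
    (half_pow_le_of_logb_le hδ (hr ▸ Nat.le_ceil _))
  have : Nonempty (Fin r) := ⟨j⟩
  have hle : Phi σ w ≤ ⨅ j : Fin r, PhiH (ω j).1 σ w := le_ciInf fun j => Phi_le_PhiH _ σ hσ w
  rw [abs_of_nonneg (sub_nonneg.2 hle)] at hω
  exact hω.trans_le (sub_le_sub_right (ciInf_le (Set.finite_range _).bddBelow j) _)
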